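/- Let N ≥ 2 be an even integer, k = N/2, and let f : [0,1) → [0,∞) be continuous with f(0) = 0 and f(r) > 0 for r ∈ (0,1), satisfying limsup_{r→0⁺} f(r)·|ln r|^σ < ∞ for some σ > 1. Let (v_j) ⊂ X_1 with ‖v_j‖_{X_1} = 1 for all j, and suppose v_j ⇀ v weakly in X_1 (meaning ∫₀¹ r^{N−k} |v_j'(r)|^{k−1} v_j'(r) g(r) dr → ∫₀¹ r^{N−k} |v'(r)|^{k−1} v'(r) g(r) dr for every measurable g with ∫₀¹ r^{N−k}|g(r)|^{(k+1)/k} dr < ∞) with v ∈ X_1, v ≢ 0. Define P = (1 − ‖v‖_{X_1}^{k+1})^{−2/N} if ‖v‖_{X_1} < 1 and P = ∞ if ‖v‖_{X_1} = 1. Then for every q with 1 < q < P, limsup_{j→∞} ∫₀¹ r^{N−1} exp(q·μ_N |v_j(r)|^{(N+2)/N + f(r)}) dr < ∞. -/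

import Mathlib

open MeasureTheory Real Set Filter
open scoped ENNReal

/-- Surface area of the unit sphere in `ℝ^N` (equals `N` times the volume of the unit ball). -/
noncomputable def omegaS (N : ℕ) : ℝ :=
  N * (volume (Metric.ball (0 : EuclideanSpace ℝ (Fin N)) 1)).toReal

/-- The normalising constant `c_N = ω_{N-1} · binom(N,k) / N`. -/
noncomputable def cN (N k : ℕ) : ℝ := omegaS N * (N.choose k) / N

/-- The critical constant `μ_N = N · (ω_{N-1} · binom(N-1,k-1) / k)^{2/N}`. -/
noncomputable def muN (N k : ℕ) : ℝ :=
  N * (omegaS N * ((N - 1).choose (k - 1)) / k) ^ ((2 : ℝ) / N)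

/-- Membership in the weighted space `X₁`: `v` is locally absolutely continuous on `(0,1)`
with derivative `v'` (in the sense of the fundamental theorem of calculus),
`v(r) → 0` as `r → 1⁻`, and the two defining weighted integrals are finite. -/
structure MemX1 (N k : ℕ) (v v' : ℝ → ℝ) : Prop where
  locAC : ∀ a ∈ Ioo (0:ℝ) 1, ∀ b ∈ Ioo (0:ℝ) 1,
    IntervalIntegrable v' volume a b ∧ v b - v a = ∫ t in a..b, v' t
  lim_one : Tendsto v (nhdsWithin 1 (Iio 1)) (nhds 0)
  grad_int : ∫⁻ r in Ioo (0:ℝ) 1, ENNReal.ofReal (r ^ (N - k) * |v' r| ^ (k + 1)) < ⊤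
  fun_int : ∫⁻ r in Ioo (0:ℝ) 1, ENNReal.ofReal (r ^ (N - 1) * |v r| ^ (k + 1)) < ⊤

/-- The norm on `X₁`: `‖v‖ = (c_N ∫₀¹ r^{N-k} |v'|^{k+1} dr)^{1/(k+1)}`. -/
noncomputable def normX1 (N k : ℕ) (v' : ℝ → ℝ) : ℝ :=
  (cN N k * ∫ r in Ioo (0:ℝ) 1, r ^ (N - k) * |v' r| ^ (k + 1)) ^ (1 / (k + 1 : ℝ))

/-- The supercritical Trudinger–Moser integral `∫₀¹ r^{N-1} exp(β |v|^{(N+2)/N + f(r)}) dr`. -/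
noncomputable def mtIntegral (N : ℕ) (β : ℝ) (f v : ℝ → ℝ) : ℝ≥0∞ :=
  ∫⁻ r in Ioo (0:ℝ) 1,
    ENNReal.ofReal (r ^ (N - 1) * exp (β * |v r| ^ (((N : ℝ) + 2) / N + f r)))

/-- Weak convergence in `X₁` of the (nonlinear gradients of the) sequence `vj'` to `w'`:
tested against all `g` with `∫₀¹ r^{N-k} |g|^{(k+1)/k} dr < ∞`. -/
def WeakConvX1 (N k : ℕ) (vj' : ℕ → ℝ → ℝ) (w' : ℝ → ℝ) : Prop :=
  ∀ g : ℝ → ℝ, Measurable g →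
    (∫⁻ r in Ioo (0:ℝ) 1, ENNReal.ofReal (r ^ (N - k) * |g r| ^ ((k + 1 : ℝ) / k)) < ⊤) →
    Tendsto (fun j => ∫ r in Ioo (0:ℝ) 1, r ^ (N - k) * |vj' j r| ^ (k - 1) * vj' j r * g r)
      atTop (nhds (∫ r in Ioo (0:ℝ) 1, r ^ (N - k) * |w' r| ^ (k - 1) * w' r * g r))

lemma holderConjugate_succ_div {k : ℕ} (hk : 0 < k) :
    (k + 1 : ℝ).HolderConjugate ((k + 1 : ℝ) / k) := by
  have hk' : (0:ℝ) < k := by exact_mod_cast hk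
  rw [Real.holderConjugate_iff]
  refine ⟨by linarith, ?_⟩
  field_simp
  ring

/-- The derivative of a function in `X₁` is a.e. measurable on `(0,1)`. -/
lemma MemX1.aestronglyMeasurable_deriv {N k : ℕ} {v v' : ℝ → ℝ} (h : MemX1 N k v v') :
    AEStronglyMeasurable v' (volume.restrict (Ioo (0:ℝ) 1)) := by
  refine LocallyIntegrableOn.aestronglyMeasurable (f := v') (fun x hx => ?_)
  have h1 : x / 2 ∈ Ioo (0:ℝ) 1 := ⟨by linarith [hx.1], by linarith [hx.2, hx.1]⟩
  have h2 : (1 + x) / 2 ∈ Ioo (0:ℝ) 1 := ⟨by linarith [hx.1], by linarith [hx.2]⟩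
  have h3 := (h.locAC _ h1 _ h2).1.1
  refine ⟨Ioc (x / 2) ((1 + x) / 2), mem_nhdsWithin_of_mem_nhds ?_, h3⟩
  exact Ioc_mem_nhds (by linarith [hx.1]) (by linarith [hx.2])

lemma MemX1.integrableOn_energy {N k : ℕ} {v v' : ℝ → ℝ} (h : MemX1 N k v v') :
    IntegrableOn (fun r => r ^ (N - k) * |v' r| ^ (k + 1)) (Ioo (0:ℝ) 1) := by
  have hm := h.aestronglyMeasurable_deriv
  refine ⟨?_, ?_⟩
  · exact ((continuous_id.pow _).aestronglyMeasurable).mul (hm.norm.pow _)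
  · rw [hasFiniteIntegral_iff_norm]
    refine lt_of_eq_of_lt (setLIntegral_congr_fun measurableSet_Ioo fun r hr => ?_) h.grad_int
    have : 0 ≤ r ^ (N - k) * |v' r| ^ (k + 1) :=
      mul_nonneg (pow_nonneg hr.1.le _) (by positivity)
    simp only [Real.norm_of_nonneg this]

lemma MemX1.abs_sub_le {k : ℕ} (hk : 0 < k) {v v' : ℝ → ℝ} (h : MemX1 (2 * k) k v v')
    {a b : ℝ} (ha : 0 < a) (hab : a ≤ b) (hb : b < 1) :
    |v b - v a| ≤ (∫ r in Ioc a b, r ^ k * |v' r| ^ (k + 1)) ^ (1 / (k + 1 : ℝ)) *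
      (log (b / a)) ^ ((k : ℝ) / (k + 1)) := by
  have hk' : (0:ℝ) < k := by exact_mod_cast hk
  have hb0 : 0 < b := ha.trans_le hab
  have hpq := holderConjugate_succ_div hk
  have hsub : Ioc a b ⊆ Ioo (0:ℝ) 1 := fun x hx => ⟨ha.trans hx.1, hx.2.trans_lt hb⟩
  have hpos : ∀ᵐ r ∂(volume.restrict (Ioc a b)), 0 < r :=
    (ae_restrict_mem measurableSet_Ioc).mono fun r hr => ha.trans hr.1
  have hm := h.aestronglyMeasurable_deriv.mono_measure (Measure.restrict_mono hsub le_rfl)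
  have hE := h.integrableOn_energy.mono_set hsub
  rw [show 2 * k - k = k by omega] at hE
  set F : ℝ → ℝ := fun r => r ^ ((k:ℝ) / (k + 1)) * |v' r| with hF
  set G : ℝ → ℝ := fun r => r ^ (-((k:ℝ) / (k + 1))) with hG
  have hFm : AEStronglyMeasurable F (volume.restrict (Ioc a b)) :=
    (by fun_prop : Measurable fun r : ℝ => r ^ ((k:ℝ) / (k + 1))).aestronglyMeasurable.mul hm.norm
  have hGm : AEStronglyMeasurable G (volume.restrict (Ioc a b)) :=
    (by fun_prop : Measurable G).aestronglyMeasurable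
  have hFp : ∀ r, 0 < r → F r ^ (k + 1 : ℝ) = r ^ k * |v' r| ^ (k + 1) := by
    intro r hr
    simp only [hF]
    rw [mul_rpow (by positivity) (abs_nonneg _), ← rpow_mul hr.le,
      div_mul_cancel₀ _ (by positivity), rpow_natCast]
    congr 1
    exact_mod_cast rpow_natCast |v' r| (k + 1)
  have hGq : ∀ r, 0 < r → G r ^ ((k + 1 : ℝ) / k) = r⁻¹ := by
    intro r hr
    simp only [hG]
    rw [← rpow_mul hr.le, ← rpow_neg_one]
    congr 1
    field_simp
  have hF0 : ∀ r, 0 < r → 0 ≤ F r := fun r hr => by simp only [hF]; positivity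
  have hG0 : ∀ r, 0 < r → 0 ≤ G r := fun r hr => by simp only [hG]; positivity
  have hinv : IntervalIntegrable (fun r : ℝ => r⁻¹) volume a b := by
    refine intervalIntegral.intervalIntegrable_inv (fun x hx => ?_) continuousOn_id
    rw [uIcc_of_le hab] at hx
    exact (ha.trans_le hx.1).ne'
  have hFL : MemLp F (ENNReal.ofReal (k + 1)) (volume.restrict (Ioc a b)) := by
    rw [← integrable_norm_rpow_iff hFm (by simp; positivity) (by simp),
      ENNReal.toReal_ofReal (by positivity)]
    refine hE.congr (hpos.mono fun r hr => ?_)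
    simp only [Real.norm_of_nonneg (hF0 r hr), hFp r hr]
  have hGL : MemLp G (ENNReal.ofReal ((k + 1 : ℝ) / k)) (volume.restrict (Ioc a b)) := by
    rw [← integrable_norm_rpow_iff hGm (by simp; positivity) (by simp),
      ENNReal.toReal_ofReal (by positivity)]
    refine Integrable.congr hinv.1 (hpos.mono fun r hr => ?_)
    simp only [Real.norm_of_nonneg (hG0 r hr), hGq r hr]
  have key := integral_mul_le_Lp_mul_Lq_of_nonneg hpq (hpos.mono hF0) (hpos.mono hG0) hFL hGL
  rw [integral_congr_ae (hpos.mono hFp), integral_congr_ae (hpos.mono hGq),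
    ← intervalIntegral.integral_of_le (f := fun r : ℝ => r⁻¹) hab,
    integral_inv_of_pos ha hb0, one_div_div] at key
  have hae := (h.locAC a ⟨ha, hab.trans_lt hb⟩ b ⟨hb0, hb⟩).2
  rw [hae, intervalIntegral.integral_of_le hab]
  rw [← Real.norm_eq_abs]
  refine (norm_integral_le_integral_norm _).trans (le_of_eq_of_le ?_ key)
  refine integral_congr_ae (hpos.mono fun r hr => ?_)
  simp only [hF, hG, Real.norm_eq_abs]
  rw [rpow_neg hr.le]
  field_simp

lemma MemX1.abs_le {k : ℕ} (hk : 0 < k) {v v' : ℝ → ℝ} (h : MemX1 (2 * k) k v v')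
    {a : ℝ} (ha : a ∈ Ioo (0:ℝ) 1) :
    |v a| ≤ (∫ r in Ioo (0:ℝ) 1, r ^ k * |v' r| ^ (k + 1)) ^ (1 / (k + 1 : ℝ)) *
      (-log a) ^ ((k : ℝ) / (k + 1)) := by
  have hE := h.integrableOn_energy
  rw [show 2 * k - k = k by omega] at hE
  have h1 : Tendsto (fun b => |v b - v a|) (nhdsWithin 1 (Iio 1)) (nhds |0 - v a|) :=
    (h.lim_one.sub_const _).abs
  rw [zero_sub, abs_neg] at h1
  refine le_of_tendsto h1 ?_
  filter_upwards [Ioo_mem_nhdsLT ha.2] with b hb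
  refine (h.abs_sub_le hk ha.1 hb.1.le hb.2).trans ?_
  have hsub : Ioc a b ⊆ Ioo (0:ℝ) 1 := fun x hx => ⟨ha.1.trans hx.1, hx.2.trans_lt hb.2⟩
  have hnn : ∀ r ∈ Ioo (0:ℝ) 1, 0 ≤ r ^ k * |v' r| ^ (k + 1) := fun r hr =>
    mul_nonneg (pow_nonneg hr.1.le _) (by positivity)
  have hb0 : 0 < b := ha.1.trans hb.1
  have hlog : log (b / a) ≤ -log a := by
    rw [log_div hb0.ne' ha.1.ne']
    linarith [log_nonpos hb0.le hb.2.le]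
  have hlog0 : 0 ≤ log (b / a) := log_nonneg (by rw [le_div_iff₀ ha.1]; linarith [hb.1])
  have h0 : 0 ≤ ∫ r in Ioc a b, r ^ k * |v' r| ^ (k + 1) :=
    setIntegral_nonneg measurableSet_Ioc fun r hr => hnn r (hsub hr)
  have h2 : ∫ r in Ioc a b, r ^ k * |v' r| ^ (k + 1) ≤
      ∫ r in Ioo (0:ℝ) 1, r ^ k * |v' r| ^ (k + 1) :=
    setIntegral_mono_set hE ((ae_restrict_mem measurableSet_Ioo).mono hnn) hsub.eventuallyLE
  have h3 := h0.trans h2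
  gcongr

lemma pow_mul_le_young {k : ℕ} (hk : 0 < k) {x y : ℝ} (hx : 0 ≤ x) (hy : 0 ≤ y) :
    x ^ k * y ≤ k / (k + 1) * x ^ (k + 1) + 1 / (k + 1) * y ^ (k + 1) := by
  have hk' : (0:ℝ) < k := by exact_mod_cast hk
  have h := Real.young_inequality_of_nonneg hy (pow_nonneg hx k) (holderConjugate_succ_div hk)
  have h1 : y ^ (k + 1 : ℝ) = y ^ (k + 1) := by exact_mod_cast rpow_natCast y (k + 1)
  have h2 : (x ^ k) ^ ((k + 1 : ℝ) / k) = x ^ (k + 1) := by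
    rw [← rpow_natCast x k, ← rpow_mul hx, mul_div_cancel₀ _ hk'.ne']
    exact_mod_cast rpow_natCast x (k + 1)
  rw [h1, h2] at h
  calc x ^ k * y = y * x ^ k := mul_comm _ _
    _ ≤ _ := h
    _ = _ := by field_simp; ring

/-- Weak lower semicontinuity of the energy on `(a, 1)`. -/
lemma WeakConvX1.eventually_lt_energy {k : ℕ} (hk : 0 < k) {v v' : ℝ → ℝ} {vj vj' : ℕ → ℝ → ℝ}
    (hmem : ∀ j, MemX1 (2 * k) k (vj j) (vj' j)) (hlim : MemX1 (2 * k) k v v')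
    (hweak : WeakConvX1 (2 * k) k vj' v') {a A : ℝ} (ha : 0 ≤ a)
    (hA : A < ∫ r in Ioo a 1, r ^ k * |v' r| ^ (k + 1)) :
    ∀ᶠ j in atTop, A < ∫ r in Ioo a 1, r ^ k * |vj' j r| ^ (k + 1) := by
  have hk' : (0:ℝ) < k := by exact_mod_cast hk
  have hsub : Ioo a 1 ⊆ Ioo (0:ℝ) 1 := Ioo_subset_Ioo_left ha
  have hkk : 2 * k - k = k := by omega
  have hE := hlim.integrableOn_energy
  have hEj := fun j => (hmem j).integrableOn_energy
  have hgrad := hlim.grad_int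
  simp only [WeakConvX1, hkk] at hE hEj hweak hgrad
  obtain ⟨g, hgm, hg⟩ := hlim.aestronglyMeasurable_deriv.aemeasurable
  have hmemI := ae_restrict_mem (μ := volume) (measurableSet_Ioo (a := (0:ℝ)) (b := 1))
  have hgi : ∀ w : ℝ → ℝ, ∫ r in Ioo (0:ℝ) 1, r ^ k * |w r| ^ (k - 1) * w r *
      (Ioo a 1).indicator g r = ∫ r in Ioo a 1, r ^ k * |w r| ^ (k - 1) * w r * v' r := by
    intro w
    have : (Ioo a 1) = Ioo (0:ℝ) 1 ∩ Ioo a 1 := (inter_eq_right.2 hsub).symm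
    rw [this, ← setIntegral_indicator measurableSet_Ioo, ← this]
    refine integral_congr_ae (hg.mono fun r hr => ?_)
    by_cases h : r ∈ Ioo a 1
    · simp [h, hr]
    · simp [h]
  have hconv := hweak ((Ioo a 1).indicator g) (hgm.indicator measurableSet_Ioo) (by
    have hb : ∀ᵐ r ∂(volume.restrict (Ioo (0:ℝ) 1)),
        ENNReal.ofReal (r ^ k * |(Ioo a 1).indicator g r| ^ ((k + 1 : ℝ) / k)) ≤
          ENNReal.ofReal 1 + ENNReal.ofReal (r ^ k * |v' r| ^ (k + 1)) := by
      filter_upwards [hg, hmemI] with r hr hr01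
      have hr0 : 0 ≤ r ^ k := pow_nonneg hr01.1.le k
      have hr1 : r ^ k ≤ 1 := pow_le_one₀ hr01.1.le hr01.2.le
      rw [← ENNReal.ofReal_add zero_le_one (mul_nonneg hr0 (by positivity))]
      refine ENNReal.ofReal_le_ofReal ?_
      have h1 : |(Ioo a 1).indicator g r| ≤ |v' r| := by
        rw [hr]
        by_cases h : r ∈ Ioo a 1 <;> simp [h]
      have h2 : |v' r| ^ ((k + 1 : ℝ) / k) ≤ 1 + |v' r| ^ (k + 1) := by
        rcases le_total |v' r| 1 with h | h
        · have := rpow_le_one (abs_nonneg _) h (z := (k + 1 : ℝ) / k) (by positivity)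
          have : 0 ≤ |v' r| ^ (k + 1) := by positivity
          linarith
        · have h3 : |v' r| ^ ((k + 1 : ℝ) / k) ≤ |v' r| ^ ((k + 1 : ℕ) : ℝ) := by
            refine rpow_le_rpow_of_exponent_le h ?_
            push_cast
            refine div_le_self (by positivity) ?_
            exact_mod_cast hk
          rw [rpow_natCast] at h3
          linarith
      calc r ^ k * |(Ioo a 1).indicator g r| ^ ((k + 1 : ℝ) / k)
          ≤ r ^ k * |v' r| ^ ((k + 1 : ℝ) / k) := by gcongr
        _ ≤ r ^ k * (1 + |v' r| ^ (k + 1)) := by gcongr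
        _ ≤ 1 + r ^ k * |v' r| ^ (k + 1) := by rw [mul_add]; linarith
    refine (lintegral_mono_ae hb).trans_lt ?_
    rw [lintegral_add_left measurable_const]
    refine ENNReal.add_lt_top.2 ⟨?_, hgrad⟩
    simp)
  simp only [hgi] at hconv
  have hself : ∫ r in Ioo a 1, r ^ k * |v' r| ^ (k - 1) * v' r * v' r =
      ∫ r in Ioo a 1, r ^ k * |v' r| ^ (k + 1) := by
    congr 1 with r
    obtain ⟨n, rfl⟩ : ∃ n, k = n + 1 := ⟨k - 1, by omega⟩
    rw [Nat.add_sub_cancel, add_assoc, pow_add |v' r| n 2, sq_abs]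
    ring
  rw [hself] at hconv
  set I := ∫ r in Ioo a 1, r ^ k * |v' r| ^ (k + 1) with hI
  have hbound : ∀ j, ∫ r in Ioo a 1, r ^ k * |vj' j r| ^ (k - 1) * vj' j r * v' r ≤
      k / (k + 1) * (∫ r in Ioo a 1, r ^ k * |vj' j r| ^ (k + 1)) + 1 / (k + 1) * I := by
    intro j
    have h1 := ((hEj j).mono_set hsub).const_mul ((k:ℝ) / (k + 1))
    have h2 := (hE.mono_set hsub).const_mul (1 / (k + 1 : ℝ))
    rw [hI, ← integral_const_mul, ← integral_const_mul, ← integral_add h1 h2]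
    refine (le_abs_self _).trans ?_
    rw [← Real.norm_eq_abs]
    refine (norm_integral_le_of_norm_le (h1.add h2) ?_).trans_eq rfl
    filter_upwards [ae_restrict_mem measurableSet_Ioo] with r hr
    have hr0 : 0 ≤ r ^ k := pow_nonneg (hsub hr).1.le k
    have h3 := pow_mul_le_young hk (abs_nonneg (vj' j r)) (abs_nonneg (v' r))
    have h4 : ‖r ^ k * |vj' j r| ^ (k - 1) * vj' j r * v' r‖ = r ^ k * (|vj' j r| ^ k * |v' r|) := by
      rw [norm_mul, norm_mul, norm_mul, Real.norm_of_nonneg hr0, Real.norm_eq_abs (v' r),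
        Real.norm_eq_abs (vj' j r), Real.norm_of_nonneg (by positivity), mul_assoc (r ^ k),
        ← pow_succ, Nat.sub_add_cancel hk, mul_assoc]
    rw [h4]
    refine (mul_le_mul_of_nonneg_left h3 hr0).trans_eq ?_
    simp only [Pi.add_apply]
    ring
  have hlt : k / (k + 1) * A + 1 / (k + 1) * I < I := by
    have : k / (k + 1) * A < k / (k + 1) * I := by gcongr
    have h5 : (k:ℝ) / (k + 1) * I + 1 / (k + 1) * I = I := by field_simp
    linarith
  filter_upwards [hconv.eventually (lt_mem_nhds hlt)] with j hj
  have := hj.trans_le (hbound j)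
  have h6 : (k:ℝ) / (k + 1) * A < k / (k + 1) * ∫ r in Ioo a 1, r ^ k * |vj' j r| ^ (k + 1) := by
    linarith
  exact lt_of_mul_lt_mul_left h6 (by positivity)

lemma exists_lt_setIntegral_Ioo {h : ℝ → ℝ} (hh : IntegrableOn h (Ioo (0:ℝ) 1)) {A : ℝ}
    (hA : A < ∫ r in Ioo (0:ℝ) 1, h r) : ∃ a ∈ Ioo (0:ℝ) 1, A < ∫ r in Ioo a 1, h r := by
  let s : ℕ → Set ℝ := fun n => Ioo (1 / ((n : ℝ) + 2)) 1
  have hU : ⋃ n, s n = Ioo (0:ℝ) 1 := by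
    ext x
    simp only [s, mem_iUnion, mem_Ioo]
    constructor
    · rintro ⟨n, h1, h2⟩
      exact ⟨lt_trans (by positivity) h1, h2⟩
    · rintro ⟨h1, h2⟩
      obtain ⟨n, hn⟩ := exists_nat_one_div_lt h1
      refine ⟨n, lt_of_le_of_lt ?_ hn, h2⟩
      gcongr
      norm_num
  have hmono : Monotone s := fun m n hmn => Ioo_subset_Ioo_left (by gcongr)
  have ht := tendsto_setIntegral_of_monotone (μ := volume) (f := h)
    (fun n => (measurableSet_Ioo : MeasurableSet (s n))) hmono (by rwa [hU])
  rw [hU] at ht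
  obtain ⟨n, hn⟩ := (ht.eventually (lt_mem_nhds hA)).exists
  refine ⟨1 / ((n : ℝ) + 2), ⟨by positivity, ?_⟩, hn⟩
  rw [div_lt_one (by positivity)]
  have : (0:ℝ) ≤ n := by positivity
  linarith

lemma tendsto_neg_log_nhdsGT_zero : Tendsto (fun r => -log r) (nhdsWithin (0:ℝ) (Ioi 0)) atTop :=
  tendsto_neg_atBot_atTop.comp tendsto_log_nhdsGT_zero

/-- The variable part of the exponent is asymptotically harmless at the origin. -/
lemma eventually_max_rpow_le {f : ℝ → ℝ} (hfnn : ∀ r ∈ Ico (0:ℝ) 1, 0 ≤ f r)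
    (hσ : ∃ σ : ℝ, 1 < σ ∧ IsBoundedUnder (· ≤ ·) (nhdsWithin (0:ℝ) (Ioi 0))
      (fun r => f r * |log r| ^ σ)) (B : ℝ) {m ε : ℝ} (hm : m ≤ 1) (hε : 0 < ε) :
    ∀ᶠ r in nhdsWithin (0:ℝ) (Ioi 0), (max 1 (B * (-log r) ^ m)) ^ f r ≤ 1 + ε := by
  obtain ⟨σ, hσ1, C, hC⟩ := hσ
  rw [eventually_map] at hC
  have h1 : Tendsto (fun x : ℝ => 2 * C * (log x / x ^ σ)) atTop (nhds (2 * C * 0)) :=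
    (isLittleO_log_rpow_atTop (by linarith : (0:ℝ) < σ)).tendsto_div_nhds_zero.const_mul _
  rw [mul_zero] at h1
  have hlog : 0 < log (1 + ε) := log_pos (by linarith)
  have h2 := tendsto_neg_log_nhdsGT_zero.eventually (h1.eventually (gt_mem_nhds hlog))
  have h3 := tendsto_neg_log_nhdsGT_zero.eventually (eventually_ge_atTop (max 1 B))
  filter_upwards [hC, h2, h3, Ioo_mem_nhdsGT (zero_lt_one' ℝ)] with r hCr h2r h3r hr
  set L := -log r with hL
  have hL1 : 1 ≤ L := (le_max_left _ _).trans h3r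
  have hLB : B ≤ L := (le_max_right _ _).trans h3r
  have hL0 : 0 < L := by linarith
  have hf := hfnn r ⟨hr.1.le, hr.2⟩
  have habs : |log r| = L := by
    rw [hL, abs_of_nonpos (by linarith)]
  rw [habs] at hCr
  have hmax : max 1 (B * L ^ m) ≤ L * L := by
    refine max_le (by nlinarith) ?_
    have : L ^ m ≤ L := by simpa using rpow_le_rpow_of_exponent_le hL1 hm
    gcongr
  have hpos : 0 < L ^ σ := rpow_pos_of_pos hL0 _
  have hfC : f r ≤ C / L ^ σ := by rwa [le_div_iff₀ hpos]
  have hlogL : 0 ≤ log L := log_nonneg hL1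
  calc (max 1 (B * L ^ m)) ^ f r ≤ (L * L) ^ f r :=
        rpow_le_rpow (by positivity) hmax hf
    _ = exp (2 * log L * f r) := by
        rw [rpow_def_of_pos (by positivity), log_mul hL0.ne' hL0.ne', two_mul]
    _ ≤ exp (log (1 + ε)) := by
        refine exp_le_exp.2 (le_trans ?_ h2r.le)
        calc 2 * log L * f r ≤ 2 * log L * (C / L ^ σ) := by gcongr
          _ = 2 * C * (log L / L ^ σ) := by ring
    _ = 1 + ε := exp_log (by linarith)

/-- Away from the origin, the nonlinearity is bounded along functions dominated by `(-log r) ^ m`,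
even if the variable exponent blows up at `r = 1`. -/
lemma exists_rpow_add_le {f : ℝ → ℝ} (hfc : ContinuousOn f (Ico 0 1))
    (hfnn : ∀ r ∈ Ico (0:ℝ) 1, 0 ≤ f r) {B m p : ℝ} (hB : 0 ≤ B) (hm : 0 < m) (hp : 0 ≤ p)
    {a : ℝ} (ha : a ∈ Ioo (0:ℝ) 1) :
    ∃ M : ℝ, ∀ r ∈ Ico a 1, ∀ x : ℝ, 0 ≤ x → x ≤ B * (-log r) ^ m → x ^ (p + f r) ≤ M := by
  have hcont : ContinuousAt (fun r : ℝ => B * (-log r) ^ m) 1 :=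
    continuousAt_const.mul
      ((continuousAt_log one_ne_zero).neg.rpow_const (Or.inr hm.le))
  have h1 : ∀ᶠ r in nhds (1:ℝ), B * (-log r) ^ m < 1 := by
    refine hcont.eventually (gt_mem_nhds ?_)
    simp [zero_rpow hm.ne']
  obtain ⟨b, hb, hb1⟩ := exists_Ioc_subset_of_mem_nhds h1 ⟨0, zero_lt_one⟩
  have hcomp : IsCompact (Icc a ((1 + max a b) / 2)) := isCompact_Icc
  have hmab : max a b < 1 := max_lt ha.2 hb
  obtain ⟨S, hS⟩ := hcomp.bddAbove_image (f := f) (hfc.mono fun x hx =>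
    ⟨ha.1.le.trans hx.1, by linarith [hx.2]⟩)
  set Y := max 1 (B * (-log a) ^ m) with hY
  have hY1 : 1 ≤ Y := le_max_left _ _
  refine ⟨max 1 (Y ^ (p + S)), fun r hr x hx hxB => ?_⟩
  have hf := hfnn r ⟨ha.1.le.trans hr.1, hr.2⟩
  rcases lt_or_ge b r with hbr | hbr
  · refine le_max_of_le_left (rpow_le_one hx ?_ (by linarith))
    exact hxB.trans (le_of_lt (hb1 ⟨hbr, hr.2.le⟩))
  · refine le_max_of_le_right ?_
    have hfS : f r ≤ S := hS ⟨r, ⟨hr.1, by linarith [le_max_right a b]⟩, rfl⟩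
    have hlogr : 0 ≤ -log r := by linarith [log_nonpos (ha.1.le.trans hr.1) hr.2.le]
    have hlog : -log r ≤ -log a := neg_le_neg (log_le_log ha.1 hr.1)
    have hxY : x ≤ Y := (hxB.trans (by gcongr)).trans (le_max_right _ _)
    calc x ^ (p + f r) ≤ Y ^ (p + f r) := rpow_le_rpow hx hxY (by linarith)
      _ ≤ Y ^ (p + S) := rpow_le_rpow_of_exponent_le hY1 (by linarith)

lemma omegaS_pos {N : ℕ} (hN : 0 < N) : 0 < omegaS N := by
  have : (0:ℝ) < N := by exact_mod_cast hN
  refine mul_pos this (ENNReal.toReal_pos ?_ measure_ball_lt_top.ne)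
  exact (Metric.measure_ball_pos volume _ one_pos).ne'

lemma cN_pos {N k : ℕ} (hN : 0 < N) (hkN : k ≤ N) : 0 < cN N k := by
  have h1 : (0:ℝ) < N := by exact_mod_cast hN
  have h2 : (0:ℝ) < N.choose k := by exact_mod_cast Nat.choose_pos hkN
  exact div_pos (mul_pos (omegaS_pos hN) h2) h1

lemma muN_eq {N k : ℕ} (hN : 0 < N) (hk : 0 < k) : muN N k = N * cN N k ^ ((2:ℝ) / N) := by
  have h1 : (N:ℝ) ≠ 0 := by exact_mod_cast hN.ne'
  have h2 : (k:ℝ) ≠ 0 := by exact_mod_cast hk.ne'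
  have h3 : (N:ℝ) * (N - 1).choose (k - 1) = N.choose k * k := by
    have := Nat.add_one_mul_choose_eq (N - 1) (k - 1)
    rw [Nat.sub_add_cancel hN, Nat.sub_add_cancel hk] at this
    exact_mod_cast this
  rw [muN, cN]
  congr 2
  field_simp
  linear_combination (omegaS N) * h3

lemma normX1_pow {N k : ℕ} (hN : 0 < N) (hkN : k ≤ N) (v' : ℝ → ℝ) :
    normX1 N k v' ^ (k + 1) =
      cN N k * ∫ r in Ioo (0:ℝ) 1, r ^ (N - k) * |v' r| ^ (k + 1) := by
  have h0 : 0 ≤ ∫ r in Ioo (0:ℝ) 1, r ^ (N - k) * |v' r| ^ (k + 1) :=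
    setIntegral_nonneg measurableSet_Ioo fun r hr =>
      mul_nonneg (pow_nonneg hr.1.le _) (by positivity)
  have h1 := mul_nonneg (cN_pos hN hkN).le h0
  rw [normX1, ← rpow_natCast, ← rpow_mul h1]
  push_cast
  rw [one_div_mul_cancel (by positivity), rpow_one]

/-- Pointwise growth: if the energy on `(0, a)` is below `D`, then `|v|` is eventually below
`D ^ (1 / (k + 1)) * (-log r) ^ (k / (k + 1))` for every larger `D`, uniformly in `v`. -/
lemma eventually_abs_le {k : ℕ} (hk : 0 < k) {a d D D' : ℝ} (ha : a ∈ Ioo (0:ℝ) 1)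
    (hD : 0 ≤ D) (hDD : D < D') :
    ∀ᶠ r in nhdsWithin (0:ℝ) (Ioi 0), ∀ v v' : ℝ → ℝ, MemX1 (2 * k) k v v' →
      (∫ r in Ioo (0:ℝ) 1, r ^ k * |v' r| ^ (k + 1)) = d →
      (∫ r in Ioc 0 a, r ^ k * |v' r| ^ (k + 1)) ≤ D →
      |v r| ≤ D' ^ (1 / (k + 1 : ℝ)) * (-log r) ^ ((k : ℝ) / (k + 1)) := by
  have hk' : (0:ℝ) < k := by exact_mod_cast hk
  set m : ℝ := (k : ℝ) / (k + 1) with hm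
  have hm0 : 0 < m := by positivity
  set e : ℝ := 1 / (k + 1 : ℝ) with he
  have he0 : 0 < e := by positivity
  have hgap : 0 < D' ^ e - D ^ e := sub_pos.2 (rpow_lt_rpow hD hDD he0)
  have ht := (((tendsto_rpow_atTop hm0).comp tendsto_neg_log_nhdsGT_zero).const_mul_atTop
    hgap).eventually (eventually_ge_atTop (d ^ e * (-log a) ^ m))
  filter_upwards [ht, Ioo_mem_nhdsGT ha.1] with r hr hra v v' hv hd hvD
  simp only [Function.comp] at hr
  have hr0 : 0 < r := hra.1
  have hsub1 : Ioc r a ⊆ Ioc 0 a := Ioc_subset_Ioc_left hr0.le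
  have hsub2 : Ioc 0 a ⊆ Ioo (0:ℝ) 1 := fun x hx => ⟨hx.1, hx.2.trans_lt ha.2⟩
  have hE := hv.integrableOn_energy
  rw [show 2 * k - k = k by omega] at hE
  have hnn : ∀ x ∈ Ioc 0 a, 0 ≤ x ^ k * |v' x| ^ (k + 1) := fun x hx =>
    mul_nonneg (pow_nonneg hx.1.le _) (by positivity)
  have h1 : ∫ x in Ioc r a, x ^ k * |v' x| ^ (k + 1) ≤ D :=
    (setIntegral_mono_set (hE.mono_set hsub2) ((ae_restrict_mem measurableSet_Ioc).mono hnn)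
      hsub1.eventuallyLE).trans hvD
  have h0 : 0 ≤ ∫ x in Ioc r a, x ^ k * |v' x| ^ (k + 1) :=
    setIntegral_nonneg measurableSet_Ioc fun x hx => hnn x (hsub1 hx)
  have h2 := hv.abs_sub_le hk hr0 hra.2.le ha.2
  have h3 := hv.abs_le hk ha
  rw [hd] at h3
  have hlog : log (a / r) ≤ -log r := by
    rw [log_div ha.1.ne' hr0.ne']
    linarith [log_nonpos ha.1.le ha.2.le]
  have hlog0 : 0 ≤ log (a / r) := log_nonneg (by rw [le_div_iff₀ hr0]; linarith [hra.2])
  have h4 : (∫ x in Ioc r a, x ^ k * |v' x| ^ (k + 1)) ^ e * log (a / r) ^ m ≤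
      D ^ e * (-log r) ^ m := by gcongr
  have h5 : |v r| ≤ |v a| + |v a - v r| := by
    have := abs_sub_abs_le_abs_sub (v r) (v a)
    rw [abs_sub_comm] at this
    linarith
  nlinarith [h2, h3, h4, h5, hr]

lemma pow_mul_one_sub_lt_one {k : ℕ} (hk : 0 < k) {q E : ℝ} (hq : 0 < q)
    (hE1 : E ≤ 1) (h : E = 1 ∨ q < (1 - E) ^ (-(2 : ℝ) / (2 * k : ℕ))) :
    q ^ k * (1 - E) < 1 := by
  have hk' : (0:ℝ) < k := by exact_mod_cast hk
  rcases eq_or_lt_of_le hE1 with h1 | h1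
  · simp [h1]
  have hpos : 0 < 1 - E := by linarith
  have h2 := h.resolve_left h1.ne
  have h3 : q ^ k < ((1 - E) ^ (-(2 : ℝ) / (2 * k : ℕ))) ^ k := pow_lt_pow_left₀ h2 hq.le hk.ne'
  rw [← rpow_natCast ((1 - E) ^ _) k, ← rpow_mul hpos.le] at h3
  push_cast at h3
  rw [show -2 / (2 * (k:ℝ)) * k = -1 by field_simp, rpow_neg_one] at h3
  calc q ^ k * (1 - E) < (1 - E)⁻¹ * (1 - E) := by gcongr
    _ = 1 := inv_mul_cancel₀ hpos.ne'

lemma mtIntegral_le {N : ℕ} (hN : 0 < N) {f v : ℝ → ℝ} {β s M a : ℝ}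
    (h1 : ∀ r ∈ Ioo 0 a, r < 1 → β * |v r| ^ (((N : ℝ) + 2) / N + f r) ≤ N * s * -log r)
    (h2 : ∀ r ∈ Ico a 1, 0 < r → β * |v r| ^ (((N : ℝ) + 2) / N + f r) ≤ M) :
    mtIntegral N β f v ≤
      ∫⁻ r in Ioo (0:ℝ) 1, ENNReal.ofReal (exp M + r ^ ((N:ℝ) * (1 - s) - 1)) := by
  refine setLIntegral_mono' measurableSet_Ioo fun r hr => ENNReal.ofReal_le_ofReal ?_
  rcases lt_or_ge r a with hra | hra
  · have h3 : r ^ (N - 1) * exp (β * |v r| ^ (((N : ℝ) + 2) / N + f r)) ≤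
        r ^ ((N:ℝ) * (1 - s) - 1) := by
      have h4 : r ^ ((N:ℝ) * (1 - s) - 1) = r ^ (N - 1) * exp (N * s * -log r) := by
        rw [← rpow_natCast, Nat.cast_sub hN, rpow_def_of_pos hr.1, rpow_def_of_pos hr.1,
          ← exp_add]
        congr 1
        push_cast
        ring
      rw [h4]
      have := hr.1
      exact mul_le_mul_of_nonneg_left (exp_le_exp.2 (h1 r ⟨hr.1, hra⟩ hr.2)) (by positivity)
    linarith [exp_pos M]
  · have h3 : r ^ (N - 1) * exp (β * |v r| ^ (((N : ℝ) + 2) / N + f r)) ≤ 1 * exp M :=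
      mul_le_mul (pow_le_one₀ hr.1.le hr.2.le) (exp_le_exp.2 (h2 r ⟨hra, hr.2⟩ hr.1))
        (exp_pos _).le zero_le_one
    linarith [rpow_nonneg hr.1.le ((N:ℝ) * (1 - s) - 1)]

lemma setLIntegral_exp_add_rpow_lt_top (M : ℝ) {β : ℝ} (hβ : -1 < β) :
    ∫⁻ r in Ioo (0:ℝ) 1, ENNReal.ofReal (exp M + r ^ β) < ⊤ := by
  have h1 : IntegrableOn (fun r : ℝ => exp M + r ^ β) (Ioo 0 1) :=
    (integrableOn_const (by simp)).add
      ((intervalIntegral.integrableOn_Ioo_rpow_iff one_pos).2 hβ)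
  exact h1.lintegral_lt_top

theorem stmt14 (N k : ℕ) (hk : 0 < k) (hN : N = 2 * k)
    (f : ℝ → ℝ) (hfc : ContinuousOn f (Ico 0 1)) (hf0 : f 0 = 0)
    (hfpos : ∀ r ∈ Ioo (0:ℝ) 1, 0 < f r) (hfnn : ∀ r ∈ Ico (0:ℝ) 1, 0 ≤ f r)
    (hσ : ∃ σ : ℝ, 1 < σ ∧ IsBoundedUnder (· ≤ ·) (nhdsWithin (0:ℝ) (Ioi 0))
      (fun r => f r * |log r| ^ σ))
    (v v' : ℝ → ℝ) (vj vj' : ℕ → ℝ → ℝ)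
    (hmem : ∀ j, MemX1 N k (vj j) (vj' j)) (hnorm : ∀ j, normX1 N k (vj' j) = 1)
    (hlim : MemX1 N k v v') (hne : ¬ ∀ r ∈ Ioo (0:ℝ) 1, v r = 0)
    (hweak : WeakConvX1 N k vj' v') :
    ∀ q : ℝ, 1 < q →
      (normX1 N k v' = 1 ∨ q < (1 - normX1 N k v' ^ (k + 1)) ^ (-(2 : ℝ) / N)) →
      limsup (fun j => mtIntegral N (q * muN N k) f (vj j)) atTop < ⊤ := by
  subst hN
  intro q hq hqP
  have hq0 : 0 < q := by linarith
  have hk' : (0:ℝ) < k := by exact_mod_cast hk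
  have hN0 : 0 < 2 * k := by omega
  have hkN : k ≤ 2 * k := by omega
  have hkk : 2 * k - k = k := by omega
  have hc := cN_pos hN0 hkN
  have hmu := muN_eq hN0 hk
  have hEn := normX1_pow (k := k) hN0 hkN
  simp only [hkk] at hEn
  have hint := hlim.integrableOn_energy
  have hintj := fun j => (hmem j).integrableOn_energy
  simp only [hkk] at hint hintj
  set c := cN (2 * k) k with hcdef
  -- total energies
  have hd : ∀ j, ∫ r in Ioo (0:ℝ) 1, r ^ k * |vj' j r| ^ (k + 1) = 1 / c := by
    intro j
    have := hEn (vj' j)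
    rw [hnorm j, one_pow] at this
    rw [eq_div_iff hc.ne', mul_comm, ← this]
  set A := ∫ r in Ioo (0:ℝ) 1, r ^ k * |v' r| ^ (k + 1) with hA
  have hA0 : 0 ≤ A := setIntegral_nonneg measurableSet_Ioo fun r hr =>
    mul_nonneg (pow_nonneg hr.1.le _) (by positivity)
  have hAle : A ≤ 1 / c := by
    by_contra! hcon
    obtain ⟨j, hj⟩ := (hweak.eventually_lt_energy hk hmem hlim le_rfl hcon).exists
    rw [hd j] at hj
    exact lt_irrefl _ hj
  have hcA : c * A ≤ 1 := by
    rw [le_div_iff₀ hc] at hAle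
    linarith
  have hqk : 0 < q ^ k := by positivity
  have hsmall : q ^ k * (1 - c * A) < 1 := by
    refine pow_mul_one_sub_lt_one hk hq0 hcA ?_
    rw [← hEn]
    exact hqP.imp (fun h => by rw [h, one_pow]) id
  have hθ : (1 - c * A) / c < 1 / q ^ k / c := by
    gcongr
    rw [lt_div_iff₀ hqk]
    linarith
  obtain ⟨D, hD1, hD2⟩ := exists_between hθ
  obtain ⟨D', hD'1, hD'2⟩ := exists_between hD2
  have hD0 : 0 ≤ D := le_trans (div_nonneg (by linarith) hc.le) hD1.le
  have hD'0 : 0 ≤ D' := hD0.trans hD'1.le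
  have hcD : (1 - c * A) / c = 1 / c - A := by field_simp
  -- energy does not concentrate at the origin
  obtain ⟨a, ha, haA⟩ := exists_lt_setIntegral_Ioo hint (A := 1 / c - D) (by
    rw [hcD] at hD1
    linarith)
  have hloc : ∀ᶠ j in atTop, ∫ r in Ioc 0 a, r ^ k * |vj' j r| ^ (k + 1) ≤ D := by
    filter_upwards [hweak.eventually_lt_energy hk hmem hlim ha.1.le haA] with j hj
    have hU : Ioc 0 a ∪ Ioo a 1 = Ioo (0:ℝ) 1 := Ioc_union_Ioo_eq_Ioo ha.1.le ha.2
    have hdisj : Disjoint (Ioc 0 a) (Ioo a 1) :=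
      Set.disjoint_left.2 fun x hx hx' => absurd hx.2 (not_le.2 hx'.1)
    have hij := hintj j
    rw [← hU] at hij
    have := setIntegral_union hdisj measurableSet_Ioo hij.left_of_union hij.right_of_union
    rw [hU, hd j] at this
    linarith
  -- the exponent constant
  set m : ℝ := (k : ℝ) / (k + 1) with hm
  set e : ℝ := 1 / (k + 1 : ℝ) with he
  have hm0 : 0 < m := by positivity
  have hm1 : m ≤ 1 := by
    rw [hm, div_le_one (by positivity)]
    linarith
  set p : ℝ := (((2 * k : ℕ) : ℝ) + 2) / (2 * k : ℕ) with hp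
  have hp0 : 0 < p := by positivity
  have hmp : m * p = 1 := by
    rw [hm, hp]
    push_cast
    field_simp
  have hep : e * p = 1 / k := by
    rw [he, hp]
    push_cast
    field_simp
  have h2k : (2:ℝ) / (2 * k : ℕ) = 1 / k := by
    push_cast
    field_simp
  rw [h2k] at hmu
  set s : ℝ := q * (c ^ (1 / k : ℝ) * D' ^ (1 / k : ℝ)) with hs
  have hs0 : 0 ≤ s := by positivity
  have hs1 : s < 1 := by
    have h1 : c * D' < (q⁻¹) ^ k := by
      rw [lt_div_iff₀ hc] at hD'2
      rw [inv_pow, ← one_div]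
      linarith
    have h2 : (c * D') ^ (1 / k : ℝ) < ((q⁻¹) ^ k) ^ (1 / k : ℝ) :=
      rpow_lt_rpow (by positivity) h1 (by positivity)
    rw [one_div, pow_rpow_inv_natCast (by positivity) hk.ne', ← one_div,
      mul_rpow hc.le hD'0] at h2
    calc s < q * q⁻¹ := by rw [hs]; gcongr
      _ = 1 := mul_inv_cancel₀ hq0.ne'
  obtain ⟨ε, hε, hsε⟩ : ∃ ε > 0, s * (1 + ε) < 1 := by
    refine ⟨(1 - s) / 2, by linarith, ?_⟩
    nlinarith
  -- near the origin
  have hnear := (eventually_abs_le hk (d := 1 / c) ha hD0 hD'1).and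
    (eventually_max_rpow_le hfnn hσ (D' ^ e) hm1 hε)
  obtain ⟨b, hb, hbnear⟩ := mem_nhdsGT_iff_exists_Ioo_subset.1 hnear
  set b' := min b (1 / 2) with hb'
  have hb'I : b' ∈ Ioo (0:ℝ) 1 :=
    ⟨lt_min hb (by norm_num), (min_le_right _ _).trans_lt (by norm_num)⟩
  have hβ : 0 ≤ q * muN (2 * k) k := by
    rw [hmu]
    positivity
  obtain ⟨M, hM⟩ := exists_rpow_add_le hfc hfnn (B := (1 / c) ^ e) (m := m) (p := p)
    (by positivity) hm0 hp0.le hb'I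
  have hev : ∀ᶠ j in atTop, mtIntegral (2 * k) (q * muN (2 * k) k) f (vj j) ≤
      ∫⁻ r in Ioo (0:ℝ) 1, ENNReal.ofReal (exp (q * muN (2 * k) k * M) +
        r ^ (((2 * k : ℕ) : ℝ) * (1 - s * (1 + ε)) - 1)) := by
    filter_upwards [hloc] with j hj
    refine mtIntegral_le hN0 (a := b') ?_ ?_
    · intro r hr hr1
      obtain ⟨h1, h2⟩ := hbnear ⟨hr.1, hr.2.trans_le (min_le_left _ _)⟩
      have h3 := h1 _ _ (hmem j) (hd j) hj
      have hL : 0 ≤ -log r := by linarith [log_nonpos hr.1.le hr1.le]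
      have hf := hfnn r ⟨hr.1.le, hr1⟩
      have h4 : |vj j r| ^ p ≤ D' ^ (1 / k : ℝ) * -log r := by
        calc |vj j r| ^ p ≤ (D' ^ e * (-log r) ^ m) ^ p :=
              rpow_le_rpow (abs_nonneg _) h3 hp0.le
          _ = D' ^ (1 / k : ℝ) * -log r := by
              rw [mul_rpow (by positivity) (by positivity), ← rpow_mul hD'0, ← rpow_mul hL,
                hmp, hep, rpow_one]
      have h5 : |vj j r| ^ f r ≤ 1 + ε :=
        (rpow_le_rpow (abs_nonneg _) (h3.trans (le_max_right _ _)) hf).trans h2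
      rw [rpow_add_of_nonneg (abs_nonneg _) hp0.le hf, hmu]
      calc q * (((2 * k : ℕ) : ℝ) * c ^ (1 / k : ℝ)) * (|vj j r| ^ p * |vj j r| ^ f r)
          ≤ q * (((2 * k : ℕ) : ℝ) * c ^ (1 / k : ℝ)) *
              ((D' ^ (1 / k : ℝ) * -log r) * (1 + ε)) := by gcongr
        _ = ((2 * k : ℕ) : ℝ) * (s * (1 + ε)) * -log r := by rw [hs]; ring
    · intro r hr hr0
      have h1 := (hmem j).abs_le hk ⟨hr0, hr.2⟩
      rw [hd j] at h1
      exact mul_le_mul_of_nonneg_left (hM r hr _ (abs_nonneg _) h1) hβ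
  refine (limsup_le_of_le (h := hev)).trans_lt (setLIntegral_exp_add_rpow_lt_top _ ?_)
  have : 0 < ((2 * k : ℕ) : ℝ) * (1 - s * (1 + ε)) :=
    mul_pos (by exact_mod_cast hN0) (by linarith)
  linarith
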